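/- arXiv:2205.07593 — 4 statements merged into one kernel-verified Lean document; each statement's English description precedes it below -/
import Mathlib

section
/- Let c ≥ 3, ε ∈ (0,1), n ≥ 2, and let u be a node with deg(u) ≥ (c/ε)·log n (so that i := ⌈τ_u⌉ ≤ n). Over a uniformly random permutation π, the probability that at the beginning of iteration i of sequential Truncated-Pivot the node u is still active and deg_i(u) > ε·deg(u) is at most n^{−c/2}. -/
open scoped Classical

namespace TruncatedPivot

/-- Status of a node during the run of (sequential) Truncated-Pivot. -/
inductive Status (N : ℕ) where
  | active : Status N
  | singleton : Status N
  | clustered : Fin N → Status N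
  deriving DecidableEq

variable {N : ℕ}

/-- Degree of `u`: number of positive edges incident on `u`. -/
def deg (adj : Fin N → Fin N → Bool) (u : Fin N) : ℕ :=
  (Finset.univ.filter fun v => adj u v = true).card

/-- Number of disagreements of the clustering whose parts are the fibers of `f`:
positive pairs split between two parts plus negative pairs inside one part. -/
def cost (adj : Fin N → Fin N → Bool) (f : Fin N → Fin N) : ℕ :=
  (Finset.univ.filter fun p : Fin N × Fin N =>
    p.1 < p.2 ∧ ((adj p.1 p.2 = true ∧ f p.1 ≠ f p.2) ∨
      (adj p.1 p.2 = false ∧ f p.1 = f p.2))).card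

/-- Minimum number of disagreements over all clusterings (every partition of `Fin N`
arises as the fibers of some `f : Fin N → Fin N`). -/
noncomputable def OPT (adj : Fin N → Fin N → Bool) : ℕ :=
  sInf (Set.range (cost adj))

/-- The singleton-creating sub-step of iteration `i` of sequential Truncated-Pivot:
every active node `v` with `deg v ≥ (c/ε)·(N·log N)/i` (equivalently
`deg v · i ≥ (c/ε)·(N·log N)`, as `i ≥ 1`) becomes a singleton cluster. -/
noncomputable def singStep (adj : Fin N → Fin N → Bool) (c ε : ℝ) (i : ℕ)
    (s : Fin N → Status N) : Fin N → Status N := fun v =>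
  if s v = Status.active ∧ (c / ε) * ((N : ℝ) * Real.log N) ≤ (deg adj v : ℝ) * (i : ℝ) then
    Status.singleton
  else s v

/-- The pivot sub-step: if `u` is still active, it forms a pivot cluster together with all
of its currently active positive neighbors. -/
def pivStep (adj : Fin N → Fin N → Bool) (u : Fin N) (s : Fin N → Status N) :
    Fin N → Status N := fun v =>
  if s u = Status.active ∧ s v = Status.active ∧ (v = u ∨ adj u v = true) then
    Status.clustered u
  else s v

/-- `seqStates adj c ε π k` is the status of every node after the first `k` iterations of
sequential Truncated-Pivot run with permutation `π` (iteration `i = k+1` processes the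
node at position `i`, i.e. `π.symm ⟨k⟩`). -/
noncomputable def seqStates (adj : Fin N → Fin N → Bool) (c ε : ℝ) (π : Equiv.Perm (Fin N)) :
    ℕ → Fin N → Status N
  | 0 => fun _ => Status.active
  | k + 1 =>
    if h : k < N then
      pivStep adj (π.symm ⟨k, h⟩) (singStep adj c ε (k + 1) (seqStates adj c ε π k))
    else seqStates adj c ε π k

/-- The cluster label (representative) of each node in the clustering output by
sequential Truncated-Pivot: members of the pivot cluster of pivot `p` get label `p`,
singleton clusters get the node itself. -/
noncomputable def seqLabel (adj : Fin N → Fin N → Bool) (c ε : ℝ) (π : Equiv.Perm (Fin N))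
    (v : Fin N) : Fin N :=
  match seqStates adj c ε π N v with
  | Status.clustered p => p
  | _ => v

/-- The state in iteration `k+1` just after the singleton sub-step and right before the
pivot sub-step. -/
noncomputable def midState (adj : Fin N → Fin N → Bool) (c ε : ℝ) (π : Equiv.Perm (Fin N))
    (k : ℕ) : Fin N → Status N :=
  singStep adj c ε (k + 1) (seqStates adj c ε π k)

/-- Membership in the (potential) pivot cluster of pivot `p`. -/
def inPivCluster (adj : Fin N → Fin N → Bool) (p v : Fin N) : Prop :=
  v = p ∨ adj p v = true

/-- The (positive) edge `{a,b}` is cut by the pivot cluster created at iteration `k+1`: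
the pivot and both endpoints are active when the cluster is created, and exactly one of
`a`, `b` is included in the cluster. -/
def cutAt (adj : Fin N → Fin N → Bool) (c ε : ℝ) (π : Equiv.Perm (Fin N)) (k : Fin N)
    (a b : Fin N) : Prop :=
  midState adj c ε π k.val (π.symm k) = Status.active ∧
  midState adj c ε π k.val a = Status.active ∧
  midState adj c ε π k.val b = Status.active ∧
  ((inPivCluster adj (π.symm k) a ∧ ¬ inPivCluster adj (π.symm k) b) ∨
    (inPivCluster adj (π.symm k) b ∧ ¬ inPivCluster adj (π.symm k) a))

/-- `C^pivot`: the number of disagreements induced by the pivot clusters of sequential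
Truncated-Pivot: negative pairs inside a common pivot cluster, plus positive edges cut
by a pivot cluster at the iteration it was created. -/
noncomputable def Cpivot (adj : Fin N → Fin N → Bool) (c ε : ℝ) (π : Equiv.Perm (Fin N)) : ℕ :=
  (Finset.univ.filter fun p : Fin N × Fin N =>
    p.1 < p.2 ∧
      ((adj p.1 p.2 = true ∧ ∃ k : Fin N, cutAt adj c ε π k p.1 p.2) ∨
        (adj p.1 p.2 = false ∧ ∃ q : Fin N,
          seqStates adj c ε π N p.1 = Status.clustered q ∧
          seqStates adj c ε π N p.2 = Status.clustered q))).card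

/-- A bad triangle: three distinct vertices with exactly two positive edges. -/
def IsBadTriangle (adj : Fin N → Fin N → Bool) (t : Finset (Fin N)) : Prop :=
  ∃ u v w : Fin N, t = {u, v, w} ∧ u ≠ v ∧ v ≠ w ∧ u ≠ w ∧
    adj u v = true ∧ adj v w = true ∧ adj u w = false

/-- The set `T` of all bad triangles. -/
noncomputable def badTriangles (adj : Fin N → Fin N → Bool) : Finset (Finset (Fin N)) :=
  Finset.univ.filter (IsBadTriangle adj)

/-- The event `A_t`: at some iteration of sequential Truncated-Pivot all three nodes of the
bad triangle `t` are active and one of them is the node of that iteration (hence it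
creates a pivot cluster). -/
def eventA (adj : Fin N → Fin N → Bool) (c ε : ℝ) (t : Finset (Fin N))
    (π : Equiv.Perm (Fin N)) : Prop :=
  ∃ k : Fin N, π.symm k ∈ t ∧ ∀ x ∈ t, midState adj c ε π k.val x = Status.active

/-- `N_i(u)`: positive neighbors `v` of `u` with `deg v ≤ deg u` that have not joined a
pivot cluster before iteration `i` (i.e. in the state at the beginning of iteration `i`). -/
noncomputable def NdegI (adj : Fin N → Fin N → Bool) (c ε : ℝ) (π : Equiv.Perm (Fin N))
    (i : ℕ) (u : Fin N) : Finset (Fin N) :=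
  Finset.univ.filter fun v => adj u v = true ∧ deg adj v ≤ deg adj u ∧
    ∀ p : Fin N, seqStates adj c ε π (i - 1) v ≠ Status.clustered p

/-- `u` is placed into a singleton cluster at iteration `i` (`1 ≤ i ≤ N`). -/
def becomesSingletonAt (adj : Fin N → Fin N → Bool) (c ε : ℝ) (π : Equiv.Perm (Fin N))
    (u : Fin N) (i : ℕ) : Prop :=
  1 ≤ i ∧ i ≤ N ∧ seqStates adj c ε π (i - 1) u = Status.active ∧
    seqStates adj c ε π i u = Status.singleton

/-- `E^sin`: positive edges with at least one endpoint in a singleton cluster. -/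
noncomputable def Esin (adj : Fin N → Fin N → Bool) (c ε : ℝ) (π : Equiv.Perm (Fin N)) :
    Finset (Fin N × Fin N) :=
  Finset.univ.filter fun p => p.1 < p.2 ∧ adj p.1 p.2 = true ∧
    (seqStates adj c ε π N p.1 = Status.singleton ∨
      seqStates adj c ε π N p.2 = Status.singleton)

/-- A good edge of `E^sin`: one endpoint is placed into a singleton cluster at some
iteration `i` and the other endpoint had joined a pivot cluster at some iteration `j < i`. -/
def goodPair (adj : Fin N → Fin N → Bool) (c ε : ℝ) (π : Equiv.Perm (Fin N))
    (a b : Fin N) : Prop :=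
  (∃ i : ℕ, becomesSingletonAt adj c ε π a i ∧
    ∃ p : Fin N, seqStates adj c ε π (i - 1) b = Status.clustered p) ∨
  (∃ i : ℕ, becomesSingletonAt adj c ε π b i ∧
    ∃ p : Fin N, seqStates adj c ε π (i - 1) a = Status.clustered p)

/-- `E^bad`: the edges of `E^sin` that are not good. -/
noncomputable def Ebad (adj : Fin N → Fin N → Bool) (c ε : ℝ) (π : Equiv.Perm (Fin N)) :
    Finset (Fin N × Fin N) :=
  (Esin adj c ε π).filter fun p => ¬ goodPair adj c ε π p.1 p.2

/-- A node `u` is interesting for permutation `π` iff `π_u < τ_u`, i.e.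
`π_u · deg u < (c/ε)·(N·log N)` where `π_u ∈ {1,…,N}` is the position of `u`. -/
def interesting (adj : Fin N → Fin N → Bool) (c ε : ℝ) (π : Equiv.Perm (Fin N))
    (u : Fin N) : Prop :=
  (((π u).val : ℝ) + 1) * (deg adj u : ℝ) < (c / ε) * ((N : ℝ) * Real.log N)

/-- The greedy maximal independent set of `G_store` (the subgraph induced by the
interesting nodes) along `π`: nodes are processed in increasing order of position and a
node joins iff it is interesting and has no earlier neighbor already in the set. -/
noncomputable def pivots (adj : Fin N → Fin N → Bool) (c ε : ℝ) (π : Equiv.Perm (Fin N)) :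
    Finset (Fin N) :=
  (List.finRange N).foldl
    (fun I j =>
      if interesting adj c ε π (π.symm j) ∧ ∀ v ∈ I, adj (π.symm j) v = false then
        insert (π.symm j) I
      else I) ∅

/-- The cluster label of each node in the clustering output by parallel Truncated-Pivot:
pivots are their own label; a non-pivot `u` joins its pivot positive neighbor `v` of
smallest position provided `π_v < τ_u`; all remaining nodes form singleton clusters. -/
noncomputable def parLabel (adj : Fin N → Fin N → Bool) (c ε : ℝ) (π : Equiv.Perm (Fin N))
    (u : Fin N) : Fin N :=
  if u ∈ pivots adj c ε π then u
  else
    let S := (pivots adj c ε π).filter fun v => adj u v = true ∧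
      (((π v).val : ℝ) + 1) * (deg adj u : ℝ) < (c / ε) * ((N : ℝ) * Real.log N)
    if h : S.Nonempty then π.symm ((S.image fun v => π v).min' (h.image _)) else u

/-- The number of positive edges with at least one interesting endpoint (i.e. with at
least one endpoint in `G_store`). -/
noncomputable def interEdges (adj : Fin N → Fin N → Bool) (c ε : ℝ)
    (π : Equiv.Perm (Fin N)) : Finset (Fin N × Fin N) :=
  Finset.univ.filter fun p => p.1 < p.2 ∧ adj p.1 p.2 = true ∧
    (interesting adj c ε π p.1 ∨ interesting adj c ε π p.2)

/-- Probability of an event over a uniformly random permutation of `Fin N`. -/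
noncomputable def Pr (N : ℕ) (P : Equiv.Perm (Fin N) → Prop) : ℝ :=
  ((Finset.univ.filter P).card : ℝ) / (Nat.factorial N : ℝ)

/-- Expectation of a real random variable over a uniformly random permutation of `Fin N`. -/
noncomputable def Ex (N : ℕ) (X : Equiv.Perm (Fin N) → ℝ) : ℝ :=
  (∑ π : Equiv.Perm (Fin N), X π) / (Nat.factorial N : ℝ)


section States

variable (adj : Fin N → Fin N → Bool) (c ε : ℝ) (π : Equiv.Perm (Fin N))

lemma singStep_eq_active {i : ℕ} {s : Fin N → Status N} {v : Fin N}
    (h : singStep adj c ε i s v = Status.active) : s v = Status.active := by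
  unfold singStep at h
  split_ifs at h
  exact h

lemma singStep_of_clustered {i : ℕ} {s : Fin N → Status N} {v p : Fin N}
    (h : s v = Status.clustered p) : singStep adj c ε i s v = Status.clustered p := by
  simp [singStep, h]

lemma pivStep_eq_active {w : Fin N} {s : Fin N → Status N} {v : Fin N}
    (h : pivStep adj w s v = Status.active) : s v = Status.active := by
  unfold pivStep at h
  split_ifs at h
  exact h

lemma pivStep_of_clustered {w : Fin N} {s : Fin N → Status N} {v p : Fin N}
    (h : s v = Status.clustered p) : pivStep adj w s v = Status.clustered p := by
  simp [pivStep, h]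

lemma pivStep_eq_singleton {w : Fin N} {s : Fin N → Status N} {v : Fin N}
    (h : pivStep adj w s v = Status.singleton) : s v = Status.singleton := by
  unfold pivStep at h
  split_ifs at h
  exact h

/-- Only active nodes become pivots, and a pivot does not stay active. -/
lemma pivStep_self_ne_active (w : Fin N) (s : Fin N → Status N) :
    pivStep adj w s w ≠ Status.active := by
  intro h
  have := pivStep_eq_active adj h
  simp [pivStep, this] at h

lemma seqStates_succ (k : Fin N) :
    seqStates adj c ε π (k + 1) =
      pivStep adj (π.symm k) (singStep adj c ε (k + 1) (seqStates adj c ε π k)) := by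
  simp [seqStates]

lemma seqStates_active_of_succ {k : ℕ} {v : Fin N}
    (h : seqStates adj c ε π (k + 1) v = Status.active) :
    seqStates adj c ε π k v = Status.active := by
  rw [seqStates] at h
  split_ifs at h
  · exact singStep_eq_active adj c ε (pivStep_eq_active adj h)
  · exact h

lemma seqStates_active_of_le {k l : ℕ} (hkl : k ≤ l) {v : Fin N}
    (h : seqStates adj c ε π l v = Status.active) :
    seqStates adj c ε π k v = Status.active := by
  induction l, hkl using Nat.le_induction with
  | base => exact h
  | succ l _ ih => exact ih (seqStates_active_of_succ adj c ε π h)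

lemma seqStates_clustered_succ {k : ℕ} {v p : Fin N}
    (h : seqStates adj c ε π k v = Status.clustered p) :
    seqStates adj c ε π (k + 1) v = Status.clustered p := by
  rw [seqStates]
  split_ifs
  · exact pivStep_of_clustered adj (singStep_of_clustered adj c ε h)
  · exact h

/-- A node which is active after `k` iterations has not been processed yet. -/
lemma le_of_seqStates_active {k : ℕ} {v : Fin N}
    (h : seqStates adj c ε π k v = Status.active) : k ≤ π v := by
  by_contra! hlt
  have h' := seqStates_active_of_le adj c ε π (Nat.succ_le_of_lt hlt) h
  rw [Nat.succ_eq_add_one, seqStates_succ, Equiv.symm_apply_apply] at h'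
  exact pivStep_self_ne_active adj _ _ h'

lemma singStep_ne_singleton {i : ℕ} {s : Fin N → Status N} {v : Fin N}
    (hs : s v ≠ Status.singleton)
    (hi : (deg adj v : ℝ) * (i : ℝ) < (c / ε) * ((N : ℝ) * Real.log N)) :
    singStep adj c ε i s v ≠ Status.singleton := by
  simpa [singStep, not_le.2 hi] using hs

/-- No node becomes a singleton before its threshold. -/
lemma seqStates_ne_singleton {k : ℕ} {v : Fin N}
    (hk : (deg adj v : ℝ) * (k : ℝ) < (c / ε) * ((N : ℝ) * Real.log N)) :
    seqStates adj c ε π k v ≠ Status.singleton := by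
  induction k with
  | zero => simp [seqStates]
  | succ k ih =>
    have hlt : (deg adj v : ℝ) * (k : ℝ) < (c / ε) * ((N : ℝ) * Real.log N) :=
      lt_of_le_of_lt (by gcongr; simp) hk
    rw [seqStates]
    split_ifs
    · exact fun h => singStep_ne_singleton adj c ε (ih hlt) hk (pivStep_eq_singleton adj h)
    · exact ih hlt

/-- The state after `k` iterations depends only on the first `k` nodes of the permutation. -/
lemma seqStates_congr {π π' : Equiv.Perm (Fin N)} {k : ℕ}
    (h : ∀ j : Fin N, (j : ℕ) < k → π.symm j = π'.symm j) :
    seqStates adj c ε π k = seqStates adj c ε π' k := by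
  induction k with
  | zero => rfl
  | succ k ih =>
    rw [seqStates, seqStates, ih fun j hj => h j (Nat.lt_succ_of_lt hj)]
    split_ifs with hk
    · rw [h ⟨k, hk⟩ (Nat.lt_succ_self k)]
    · rfl

lemma seqStates_trans_swap {k j : Fin N} (hkj : k ≤ j) :
    seqStates adj c ε (π.trans (Equiv.swap k j)) k = seqStates adj c ε π k := by
  refine seqStates_congr adj c ε fun l hl => ?_
  have hlk : l < k := hl
  rw [Equiv.symm_trans_apply, Equiv.symm_swap,
    Equiv.swap_apply_of_ne_of_ne hlk.ne (hlk.trans_le hkj).ne]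

lemma NdegI_congr {π π' : Equiv.Perm (Fin N)} {i i' : ℕ} (u : Fin N)
    (h : seqStates adj c ε π (i - 1) = seqStates adj c ε π' (i' - 1)) :
    NdegI adj c ε π i u = NdegI adj c ε π' i' u := by
  simp only [NdegI, h]

lemma NdegI_succ_subset (k : ℕ) (u : Fin N) :
    NdegI adj c ε π (k + 1 + 1) u ⊆ NdegI adj c ε π (k + 1) u := by
  intro v hv
  simp only [NdegI, Finset.mem_filter, Finset.mem_univ, true_and, Nat.add_sub_cancel] at hv ⊢
  exact ⟨hv.1, hv.2.1, fun p hp => hv.2.2 p (seqStates_clustered_succ adj c ε π hp)⟩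

variable {adj c ε π}

/-- Before the threshold of `u`, the members of `NdegI` are active. -/
lemma seqStates_active_of_mem_NdegI {k : ℕ} {u v : Fin N}
    (hk : (deg adj u : ℝ) * (k : ℝ) < (c / ε) * ((N : ℝ) * Real.log N))
    (hv : v ∈ NdegI adj c ε π (k + 1) u) : seqStates adj c ε π k v = Status.active := by
  simp only [NdegI, Finset.mem_filter, Finset.mem_univ, true_and, Nat.add_sub_cancel] at hv
  have hd : (deg adj v : ℝ) ≤ deg adj u := by exact_mod_cast hv.2.1
  have hs := seqStates_ne_singleton adj c ε π (k := k) (v := v)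
    (lt_of_le_of_lt (by gcongr) hk)
  cases h : seqStates adj c ε π k v with
  | active => rfl
  | singleton => exact absurd h hs
  | clustered p => exact absurd h (hv.2.2 p)

/-- Before its threshold, `u` stays active only if no member of `NdegI` is processed. -/
lemma notMem_NdegI_of_active (hsymm : ∀ u v, adj u v = adj v u) {k : Fin N} {u : Fin N}
    (hk : (deg adj u : ℝ) * ((k + 1 : ℕ) : ℝ) < (c / ε) * ((N : ℝ) * Real.log N))
    (hu : seqStates adj c ε π (k + 1) u = Status.active) :
    π.symm k ∉ NdegI adj c ε π (k + 1) u := by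
  intro hv
  have hk' : (deg adj u : ℝ) * ((k : ℕ) : ℝ) < (c / ε) * ((N : ℝ) * Real.log N) :=
    lt_of_le_of_lt (by gcongr; simp) hk
  have hact := seqStates_active_of_mem_NdegI hk' hv
  simp only [NdegI, Finset.mem_filter, Finset.mem_univ, true_and] at hv
  have hd : (deg adj (π.symm k) : ℝ) ≤ deg adj u := by exact_mod_cast hv.2.1
  have hlt : (deg adj (π.symm k) : ℝ) * ((k + 1 : ℕ) : ℝ)
      < (c / ε) * ((N : ℝ) * Real.log N) := lt_of_le_of_lt (by gcongr) hk
  rw [seqStates_succ] at hu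
  have hmid_u := pivStep_eq_active adj hu
  have hmid : singStep adj c ε (k + 1) (seqStates adj c ε π k) (π.symm k) = Status.active := by
    simp only [singStep, hact, not_le.2 hlt, and_false, if_false]
  have hadj : adj (π.symm k) u = true := by rw [hsymm]; exact hv.1
  simp [pivStep, hmid, hmid_u, hadj] at hu

end States

section Counting

/-- If the event `E` and the random set `M` are invariant under exchanging position `k` with any
later position, and on `E` the set `M` consists of at least `m` nodes at positions `≥ k`, then
conditionally on `E` the node at position `k` lies in `M` with probability at least `m / N`. -/
lemma mul_card_le_card_filter_mem (k : Fin N) (E : Equiv.Perm (Fin N) → Prop)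
    (M : Equiv.Perm (Fin N) → Finset (Fin N)) (m : ℝ)
    (hE : ∀ π j, k ≤ j → E π → E (π.trans (Equiv.swap k j)))
    (hM : ∀ π j, k ≤ j → M (π.trans (Equiv.swap k j)) = M π)
    (hpos : ∀ π, E π → ∀ v ∈ M π, k ≤ π v)
    (hm : ∀ π, E π → m ≤ ((M π).card : ℝ)) :
    m * ((Finset.univ.filter E).card : ℝ) ≤
      N * ((Finset.univ.filter fun π => E π ∧ π.symm k ∈ M π).card : ℝ) := by
  have hj (j : Fin N) : (Finset.univ.filter fun π => E π ∧ π.symm j ∈ M π).card ≤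
      (Finset.univ.filter fun π => E π ∧ π.symm k ∈ M π).card := by
    refine Finset.card_le_card_of_injOn (fun π => π.trans (Equiv.swap k j)) ?_ ?_
    · intro π hπ
      simp only [Finset.coe_filter, Finset.mem_univ, true_and, Set.mem_ofPred_eq] at hπ ⊢
      have hkj : k ≤ j := by simpa using hpos π hπ.1 _ hπ.2
      refine ⟨hE π j hkj hπ.1, ?_⟩
      rw [hM π j hkj, Equiv.symm_trans_apply, Equiv.symm_swap, Equiv.swap_apply_left]
      exact hπ.2
    · intro π _ π' _ h
      exact Equiv.ext fun x => (Equiv.swap k j).injective (DFunLike.congr_fun h x)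
  have hcard (π : Equiv.Perm (Fin N)) :
      (M π).card = (Finset.univ.filter fun j => π.symm j ∈ M π).card := by
    refine (Finset.card_bij (fun j _ => π.symm j) ?_ ?_ ?_).symm
    · intro j hj
      simpa using hj
    · intro a _ b _ h
      exact π.symm.injective h
    · intro v hv
      exact ⟨π v, by simpa using hv, by simp⟩
  have hsum : ∑ π ∈ Finset.univ.filter E, (M π).card =
      ∑ j : Fin N, (Finset.univ.filter fun π => E π ∧ π.symm j ∈ M π).card := by
    simp_rw [hcard, ← Finset.filter_filter, Finset.card_filter _ Finset.univ,
      Finset.card_filter _ (Finset.univ.filter E)]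
    exact Finset.sum_comm
  calc m * ((Finset.univ.filter E).card : ℝ)
      = ∑ π ∈ Finset.univ.filter E, m := by rw [Finset.sum_const, nsmul_eq_mul, mul_comm]
    _ ≤ ∑ π ∈ Finset.univ.filter E, ((M π).card : ℝ) :=
        Finset.sum_le_sum fun π hπ => hm π (Finset.mem_filter.1 hπ).2
    _ = ((∑ j : Fin N, (Finset.univ.filter fun π => E π ∧ π.symm j ∈ M π).card : ℕ) : ℝ) := by
        rw [← hsum, Nat.cast_sum]
    _ ≤ ((∑ _j : Fin N, (Finset.univ.filter fun π => E π ∧ π.symm k ∈ M π).card : ℕ) : ℝ) := by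
        exact_mod_cast Finset.sum_le_sum fun j _ => hj j
    _ = _ := by simp

lemma Pr_mono {P Q : Equiv.Perm (Fin N) → Prop} (h : ∀ π, P π → Q π) : Pr N P ≤ Pr N Q := by
  unfold Pr
  gcongr with π
  exact h π

lemma Pr_le_one (P : Equiv.Perm (Fin N) → Prop) : Pr N P ≤ 1 := by
  unfold Pr
  refine div_le_one_of_le₀ ?_ (by positivity)
  have := Finset.card_le_univ (Finset.univ.filter P)
  rw [Fintype.card_perm, Fintype.card_fin] at this
  exact_mod_cast this

lemma Pr_and_notMem_le (k : Fin N) (E : Equiv.Perm (Fin N) → Prop)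
    (M : Equiv.Perm (Fin N) → Finset (Fin N)) (m : ℝ)
    (hE : ∀ π j, k ≤ j → E π → E (π.trans (Equiv.swap k j)))
    (hM : ∀ π j, k ≤ j → M (π.trans (Equiv.swap k j)) = M π)
    (hpos : ∀ π, E π → ∀ v ∈ M π, k ≤ π v)
    (hm : ∀ π, E π → m ≤ ((M π).card : ℝ)) :
    Pr N (fun π => E π ∧ π.symm k ∉ M π) ≤ (1 - m / N) * Pr N E := by
  have h := mul_card_le_card_filter_mem k E M m hE hM hpos hm
  have hN : (0 : ℝ) < N := by exact_mod_cast k.pos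
  have hsplit : ((Finset.univ.filter E).card : ℝ) =
      (Finset.univ.filter fun π => E π ∧ π.symm k ∈ M π).card +
      (Finset.univ.filter fun π => E π ∧ π.symm k ∉ M π).card := by
    have := Finset.card_filter_add_card_filter_not (s := Finset.univ.filter E)
      (fun π => π.symm k ∈ M π)
    rw [Finset.filter_filter, Finset.filter_filter] at this
    exact_mod_cast this.symm
  have hdiv : m / N * ((Finset.univ.filter E).card : ℝ) ≤
      (Finset.univ.filter fun π => E π ∧ π.symm k ∈ M π).card := by
    rw [div_mul_eq_mul_div, div_le_iff₀ hN]
    linarith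
  unfold Pr
  rw [← mul_div_assoc]
  gcongr
  have key : ((Finset.univ.filter fun π => E π ∧ π.symm k ∉ M π).card : ℝ) ≤
      (1 - m / N) * ((Finset.univ.filter E).card : ℝ) := by
    linarith
  exact le_of_eq_of_le (by congr) key

end Counting

/-- The probability that `u` is active and has many unclustered low-degree neighbors after `k`
iterations decays geometrically in `k` before the threshold of `u`. -/
lemma Pr_active_le_pow (c ε : ℝ) (adj : Fin N → Fin N → Bool)
    (hsymm : ∀ u v, adj u v = adj v u) (u : Fin N) (m : ℝ) (hmN : m ≤ N)
    (k : ℕ) (hkN : k ≤ N)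
    (hk : (deg adj u : ℝ) * (k : ℝ) < (c / ε) * ((N : ℝ) * Real.log N)) :
    Pr N (fun π => seqStates adj c ε π k u = Status.active ∧
      m < ((NdegI adj c ε π (k + 1) u).card : ℝ)) ≤ (1 - m / N) ^ k := by
  induction k with
  | zero => simpa using Pr_le_one _
  | succ k ih =>
    have hk' : (deg adj u : ℝ) * (k : ℝ) < (c / ε) * ((N : ℝ) * Real.log N) :=
      lt_of_le_of_lt (by gcongr; simp) hk
    let K : Fin N := ⟨k, hkN⟩
    have hM (π : Equiv.Perm (Fin N)) (j : Fin N) (hj : K ≤ j) :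
        NdegI adj c ε (π.trans (Equiv.swap K j)) (k + 1) u = NdegI adj c ε π (k + 1) u :=
      NdegI_congr adj c ε u (seqStates_trans_swap adj c ε π hj)
    have hnonneg : 0 ≤ 1 - m / N :=
      sub_nonneg.2 (div_le_one_of_le₀ hmN (Nat.cast_nonneg N))
    calc _ ≤ Pr N (fun π => (seqStates adj c ε π k u = Status.active ∧
            m < ((NdegI adj c ε π (k + 1) u).card : ℝ)) ∧
            π.symm K ∉ NdegI adj c ε π (k + 1) u) := by
          refine Pr_mono fun π hπ => ⟨⟨seqStates_active_of_succ adj c ε π hπ.1, ?_⟩,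
            notMem_NdegI_of_active hsymm (k := K) hk hπ.1⟩
          refine hπ.2.trans_le ?_
          exact_mod_cast Finset.card_le_card (NdegI_succ_subset adj c ε π k u)
      _ ≤ (1 - m / N) * Pr N (fun π => seqStates adj c ε π k u = Status.active ∧
            m < ((NdegI adj c ε π (k + 1) u).card : ℝ)) := by
          refine Pr_and_notMem_le K _ _ m ?_ hM ?_ fun π hπ => hπ.2.le
          · intro π j hj hπ
            rw [hM π j hj, show seqStates adj c ε (π.trans (Equiv.swap K j)) k =
              seqStates adj c ε π k from seqStates_trans_swap adj c ε π hj]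
            exact hπ
          · intro π _ v hv
            exact le_of_seqStates_active adj c ε π (seqStates_active_of_mem_NdegI hk' hv)
      _ ≤ (1 - m / N) * (1 - m / N) ^ k := by
          gcongr
          exact ih (Nat.le_of_succ_le hkN) hk'
      _ = _ := (pow_succ' _ _).symm

/-- Let `c ≥ 3`, `ε ∈ (0,1)`, `n ≥ 2`, and let `u` be a node with
`deg u ≥ (c/ε)·log n` (so that `i := ⌈τ_u⌉ ≤ n`). Over a uniformly random permutation,
the probability that at the beginning of iteration `i` of sequential Truncated-Pivot the
node `u` is still active and `deg_i(u) > ε·deg(u)` is at most `n^(-c/2)`. -/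
theorem prob_active_high_degree (N : ℕ) (hN : 2 ≤ N) (c ε : ℝ) (hc : 3 ≤ c)
    (hε0 : 0 < ε) (hε1 : ε < 1) (adj : Fin N → Fin N → Bool)
    (hsymm : ∀ u v, adj u v = adj v u) (hirr : ∀ u, adj u u = false)
    (u : Fin N) (hdeg : (c / ε) * Real.log N ≤ (deg adj u : ℝ)) :
    Pr N (fun π =>
      seqStates adj c ε π
          (⌈(c / ε) * ((N : ℝ) * Real.log N) / (deg adj u : ℝ)⌉₊ - 1) u = Status.active ∧
      ε * (deg adj u : ℝ) <
        ((NdegI adj c ε π ⌈(c / ε) * ((N : ℝ) * Real.log N) / (deg adj u : ℝ)⌉₊ u).card : ℝ))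
      ≤ (N : ℝ) ^ (-(c / 2)) := by
  set d : ℝ := (deg adj u : ℝ) with hd
  set τ : ℝ := (c / ε) * ((N : ℝ) * Real.log N) / d with hτ
  have hNpos : (0 : ℝ) < N := by positivity
  have hlog2 : Real.log 2 ≤ Real.log N :=
    Real.log_le_log (by norm_num) (by exact_mod_cast hN)
  have hlog : 0 < Real.log N := (Real.log_pos one_lt_two).trans_le hlog2
  have hcε : 0 < c / ε := by positivity
  have hdpos : 0 < d := lt_of_lt_of_le (by positivity) hdeg
  have hdN : d ≤ N := by
    have : deg adj u ≤ N := by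
      simpa [deg] using Finset.card_le_univ (Finset.univ.filter fun v => adj u v = true)
    exact Nat.cast_le.2 this
  have hmN : ε * d ≤ N := by nlinarith
  have hτpos : 0 < τ := by positivity
  have hτN : τ ≤ N := by
    rw [hτ, div_le_iff₀ hdpos]
    nlinarith
  have hceil : ⌈τ⌉₊ - 1 + 1 = ⌈τ⌉₊ := Nat.sub_add_cancel (Nat.ceil_pos.2 hτpos)
  have hlt : ((⌈τ⌉₊ - 1 : ℕ) : ℝ) < τ :=
    Nat.lt_ceil.1 (Nat.sub_lt (Nat.ceil_pos.2 hτpos) one_pos)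
  have hle : τ - 1 ≤ ((⌈τ⌉₊ - 1 : ℕ) : ℝ) := by
    have h1 : τ ≤ ((⌈τ⌉₊ - 1 + 1 : ℕ) : ℝ) := hceil.symm ▸ Nat.le_ceil τ
    push_cast at h1
    linarith
  have hkN : ⌈τ⌉₊ - 1 ≤ N := (Nat.sub_le _ _).trans (Nat.ceil_le.2 hτN)
  have hk : d * ((⌈τ⌉₊ - 1 : ℕ) : ℝ) < (c / ε) * ((N : ℝ) * Real.log N) := by
    rw [mul_comm]
    exact (lt_div_iff₀ hdpos).1 hlt
  have hmain := Pr_active_le_pow c ε adj hsymm u (ε * d) hmN (⌈τ⌉₊ - 1) hkN hk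
  rw [hceil] at hmain
  refine hmain.trans ?_
  have hp1 : ε * d / N ≤ 1 := div_le_one_of_le₀ hmN hNpos.le
  have hp0 : 0 ≤ ε * d / N := by positivity
  have hpτ : ε * d / N * τ = c * Real.log N := by
    rw [hτ]
    field_simp
  have hexp : c / 2 * Real.log N ≤ ε * d / N * ((⌈τ⌉₊ - 1 : ℕ) : ℝ) := by
    have h1 := mul_le_mul_of_nonneg_left hle hp0
    have h2 := Real.log_two_gt_d9
    nlinarith
  calc (1 - ε * d / N) ^ (⌈τ⌉₊ - 1)
      ≤ Real.exp (-(ε * d / N)) ^ (⌈τ⌉₊ - 1) :=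
        pow_le_pow_left₀ (sub_nonneg.2 hp1) (Real.one_sub_le_exp_neg _) _
    _ = Real.exp (-(ε * d / N * ((⌈τ⌉₊ - 1 : ℕ) : ℝ))) := by
        rw [← Real.exp_nat_mul]
        ring_nf
    _ ≤ Real.exp (Real.log N * -(c / 2)) := by
        apply Real.exp_le_exp.2
        linarith
    _ = (N : ℝ) ^ (-(c / 2)) := (Real.rpow_def_of_pos hNpos _).symm


end TruncatedPivot
end

section
/- Fix ε ∈ (0,1), c > 0 and a permutation π of V such that in the run of sequential Truncated-Pivot with π, every node u that is placed into a singleton cluster at iteration i satisfies deg_i(u) ≤ ε·deg(u). Then |E^bad| ≤ 2ε·|E^sin|. -/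
open scoped Classical

namespace TruncatedPivot

variable {N : ℕ}

/-- A node that is no longer active keeps its status in the next iteration. -/
lemma seqStates_succ_of_ne_active (adj : Fin N → Fin N → Bool) (c ε : ℝ)
    (π : Equiv.Perm (Fin N)) (k : ℕ) (v : Fin N)
    (h : seqStates adj c ε π k v ≠ Status.active) :
    seqStates adj c ε π (k + 1) v = seqStates adj c ε π k v := by
  by_cases hk : k < N <;> simp [seqStates, hk, pivStep, singStep, h]

/-- Once a node is no longer active, its status is final. -/
lemma seqStates_eq_of_le (adj : Fin N → Fin N → Bool) (c ε : ℝ)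
    (π : Equiv.Perm (Fin N)) {k m : ℕ} (hkm : k ≤ m) (v : Fin N)
    (h : seqStates adj c ε π k v ≠ Status.active) :
    seqStates adj c ε π m v = seqStates adj c ε π k v := by
  induction m, hkm using Nat.le_induction with
  | base => rfl
  | succ m _ ih =>
    rw [seqStates_succ_of_ne_active adj c ε π m v (by rwa [ih]), ih]

/-- An active node with degree at least the threshold becomes a singleton. -/
lemma seqStates_succ_eq_singleton (adj : Fin N → Fin N → Bool) (c ε : ℝ)
    (π : Equiv.Perm (Fin N)) {k : ℕ} (hk : k < N) {v : Fin N}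
    (h : seqStates adj c ε π k v = Status.active)
    (hdeg : (c / ε) * ((N : ℝ) * Real.log N) ≤ (deg adj v : ℝ) * ((k + 1 : ℕ) : ℝ)) :
    seqStates adj c ε π (k + 1) v = Status.singleton := by
  have hs : singStep adj c ε (k + 1) (seqStates adj c ε π k) v = Status.singleton :=
    if_pos ⟨h, hdeg⟩
  simp [seqStates, hk, pivStep, hs]

/-- A node that becomes a singleton has degree at least the threshold. -/
lemma threshold_le_of_seqStates_succ_eq_singleton (adj : Fin N → Fin N → Bool) (c ε : ℝ)
    (π : Equiv.Perm (Fin N)) {k : ℕ} (hk : k < N) {v : Fin N}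
    (h : seqStates adj c ε π k v = Status.active)
    (hs : seqStates adj c ε π (k + 1) v = Status.singleton) :
    (c / ε) * ((N : ℝ) * Real.log N) ≤ (deg adj v : ℝ) * ((k + 1 : ℕ) : ℝ) := by
  by_contra hdeg
  have hm : singStep adj c ε (k + 1) (seqStates adj c ε π k) v = Status.active := by
    rw [singStep, if_neg fun H => hdeg H.2, h]
  rw [seqStates, dif_pos hk, pivStep] at hs
  split_ifs at hs
  rw [hm] at hs
  cases hs

/-- Every final singleton was created at some iteration. -/
lemma exists_becomesSingletonAt (adj : Fin N → Fin N → Bool) (c ε : ℝ)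
    (π : Equiv.Perm (Fin N)) {v : Fin N}
    (h : seqStates adj c ε π N v = Status.singleton) :
    ∃ i, becomesSingletonAt adj c ε π v i := by
  suffices H : ∀ k ≤ N, seqStates adj c ε π k v = Status.singleton →
      ∃ i, becomesSingletonAt adj c ε π v i from H N le_rfl h
  intro k
  induction k with
  | zero => intro _ h0; cases h0
  | succ k ih =>
    intro hk hs
    by_cases ha : seqStates adj c ε π k v = Status.active
    · exact ⟨k + 1, Nat.le_add_left 1 k, hk, ha, hs⟩
    · exact ih (Nat.le_of_succ_le hk) (by
        rwa [seqStates_succ_of_ne_active adj c ε π k v ha] at hs)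

/-- If `u` becomes a singleton at iteration `i`, then a neighbor of `u` that is not yet
clustered and does not end up as a singleton belongs to `N_i(u)`. -/
lemma mem_NdegI_of_ne_singleton {adj : Fin N → Fin N → Bool} {c ε : ℝ}
    {π : Equiv.Perm (Fin N)} {u v : Fin N} {i : ℕ}
    (hu : becomesSingletonAt adj c ε π u i) (hadj : adj u v = true)
    (hv : seqStates adj c ε π N v ≠ Status.singleton)
    (hnc : ∀ p, seqStates adj c ε π (i - 1) v ≠ Status.clustered p) :
    v ∈ NdegI adj c ε π i u := by
  obtain ⟨hi, hiN, hua, hus⟩ := hu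
  obtain ⟨k, rfl⟩ : ∃ k, i = k + 1 := ⟨i - 1, by omega⟩
  rw [Nat.add_sub_cancel] at hua hnc
  simp only [NdegI, Finset.mem_filter, Finset.mem_univ, true_and, Nat.add_sub_cancel]
  refine ⟨hadj, ?_, hnc⟩
  have hva : seqStates adj c ε π k v = Status.active := by
    cases hst : seqStates adj c ε π k v with
    | active => rfl
    | singleton =>
      exact absurd ((seqStates_eq_of_le adj c ε π (Nat.le_of_succ_le hiN) v
        (by rw [hst]; nofun)).trans hst) hv
    | clustered p => exact absurd hst (hnc p)
  have htu := threshold_le_of_seqStates_succ_eq_singleton adj c ε π hiN hua hus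
  by_contra hlt
  have hle : (deg adj u : ℝ) ≤ deg adj v := by exact_mod_cast (not_le.mp hlt).le
  have hvs := seqStates_succ_eq_singleton adj c ε π hiN hva (htu.trans (by gcongr))
  exact hv ((seqStates_eq_of_le adj c ε π hiN v (by rw [hvs]; nofun)).trans hvs)

/-- If `u` becomes a singleton at iteration `i`, then a neighbor of `u` of no larger degree
that ends up as a singleton belongs to `N_i(u)`. -/
lemma mem_NdegI_of_singleton {adj : Fin N → Fin N → Bool} {c ε : ℝ}
    {π : Equiv.Perm (Fin N)} {u v : Fin N} {i : ℕ}
    (hu : becomesSingletonAt adj c ε π u i) (hadj : adj u v = true)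
    (hv : seqStates adj c ε π N v = Status.singleton) (hdeg : deg adj v ≤ deg adj u) :
    v ∈ NdegI adj c ε π i u := by
  simp only [NdegI, Finset.mem_filter, Finset.mem_univ, true_and]
  refine ⟨hadj, hdeg, fun p hp => ?_⟩
  have h := seqStates_eq_of_le adj c ε π ((Nat.sub_le i 1).trans hu.2.1) v (by rw [hp]; nofun)
  rw [hv, hp] at h
  cases h

/-- The nodes that end up in singleton clusters. -/
noncomputable def singletons (adj : Fin N → Fin N → Bool) (c ε : ℝ)
    (π : Equiv.Perm (Fin N)) : Finset (Fin N) :=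
  Finset.univ.filter fun u => seqStates adj c ε π N u = Status.singleton

/-- Each edge of `E^bad` joins a singleton node `u`, created at iteration `t u`, to a member
of `N_{t u}(u)`. -/
lemma card_Ebad_le_sum (adj : Fin N → Fin N → Bool) (c ε : ℝ)
    (hsymm : ∀ u v, adj u v = adj v u) (π : Equiv.Perm (Fin N)) (t : Fin N → ℕ)
    (ht : ∀ u ∈ singletons adj c ε π, becomesSingletonAt adj c ε π u (t u)) :
    (Ebad adj c ε π).card ≤
      ∑ u ∈ singletons adj c ε π, (NdegI adj c ε π (t u) u).card := by
  rw [← Finset.card_sigma]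
  refine (Finset.card_le_card fun p hp => ?_).trans
    (Finset.card_image_le (f := fun x : (_ : Fin N) × Fin N => (min x.1 x.2, max x.1 x.2)))
  obtain ⟨a, b⟩ := p
  simp only [Ebad, Esin, goodPair, Finset.mem_filter, Finset.mem_univ, true_and, not_or,
    not_exists, not_and] at hp
  obtain ⟨⟨hlt, hab, hs⟩, hga, hgb⟩ := hp
  have hba : adj b a = true := hsymm a b ▸ hab
  have hsing : ∀ u, seqStates adj c ε π N u = Status.singleton →
      u ∈ singletons adj c ε π := by simp [singletons]
  suffices H : (a ∈ singletons adj c ε π ∧ b ∈ NdegI adj c ε π (t a) a) ∨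
      (b ∈ singletons adj c ε π ∧ a ∈ NdegI adj c ε π (t b) b) by
    rw [Finset.mem_image]
    rcases H with H | H
    · exact ⟨⟨a, b⟩, Finset.mem_sigma.mpr H, by simp [hlt.le]⟩
    · exact ⟨⟨b, a⟩, Finset.mem_sigma.mpr H, by simp [hlt.le]⟩
  by_cases ha : seqStates adj c ε π N a = Status.singleton
  · have hta := ht a (hsing a ha)
    by_cases hb : seqStates adj c ε π N b = Status.singleton
    · have htb := ht b (hsing b hb)
      rcases le_total (deg adj b) (deg adj a) with hd | hd
      · exact .inl ⟨hsing a ha, mem_NdegI_of_singleton hta hab hb hd⟩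
      · exact .inr ⟨hsing b hb, mem_NdegI_of_singleton htb hba ha hd⟩
    · exact .inl ⟨hsing a ha, mem_NdegI_of_ne_singleton hta hab hb (hga _ hta)⟩
  · have hb := hs.resolve_left ha
    have htb := ht b (hsing b hb)
    exact .inr ⟨hsing b hb, mem_NdegI_of_ne_singleton htb hba ha (hgb _ htb)⟩

/-- The degrees of the singleton nodes sum to at most `2 |E^sin|`. -/
lemma sum_deg_singletons_le (adj : Fin N → Fin N → Bool) (c ε : ℝ)
    (hsymm : ∀ u v, adj u v = adj v u) (hirr : ∀ u, adj u u = false)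
    (π : Equiv.Perm (Fin N)) :
    ∑ u ∈ singletons adj c ε π, deg adj u ≤ 2 * (Esin adj c ε π).card := by
  simp only [deg]
  rw [← Finset.card_sigma]
  have hsub : ((singletons adj c ε π).sigma fun u => Finset.univ.filter fun v => adj u v = true) ⊆
      (Esin adj c ε π).image (fun p => (⟨p.1, p.2⟩ : (_ : Fin N) × Fin N)) ∪
        (Esin adj c ε π).image (fun p => (⟨p.2, p.1⟩ : (_ : Fin N) × Fin N)) := by
    rintro ⟨u, v⟩ h
    simp only [singletons, Finset.mem_sigma, Finset.mem_filter, Finset.mem_univ,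
      true_and] at h
    obtain ⟨hs, hadj⟩ := h
    rw [Finset.mem_union, Finset.mem_image, Finset.mem_image]
    rcases lt_trichotomy u v with huv | rfl | hvu
    · exact .inl ⟨(u, v), by simp [Esin, huv, hadj, hs], rfl⟩
    · simp [hirr] at hadj
    · exact .inr ⟨(v, u), by simp [Esin, hvu, hsymm v u, hadj, hs], rfl⟩
  calc _ ≤ _ := Finset.card_le_card hsub
    _ ≤ _ := Finset.card_union_le _ _
    _ ≤ _ := Nat.add_le_add Finset.card_image_le Finset.card_image_le
    _ = _ := (two_mul _).symm

/-- Fix `ε ∈ (0,1)`, `c > 0` and a permutation `π` such that in the run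
of sequential Truncated-Pivot with `π`, every node `u` placed into a singleton cluster at
iteration `i` satisfies `deg_i(u) ≤ ε·deg(u)`. Then `|E^bad| ≤ 2ε·|E^sin|`. -/
theorem Ebad_le_Esin (N : ℕ) (c ε : ℝ) (hc : 0 < c) (hε0 : 0 < ε) (hε1 : ε < 1)
    (adj : Fin N → Fin N → Bool)
    (hsymm : ∀ u v, adj u v = adj v u) (hirr : ∀ u, adj u u = false)
    (π : Equiv.Perm (Fin N))
    (hsing : ∀ i : ℕ, ∀ u : Fin N, becomesSingletonAt adj c ε π u i →
      ((NdegI adj c ε π i u).card : ℝ) ≤ ε * (deg adj u : ℝ)) :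
    ((Ebad adj c ε π).card : ℝ) ≤ 2 * ε * ((Esin adj c ε π).card : ℝ) := by
  have hex : ∀ u, ∃ i, u ∈ singletons adj c ε π → becomesSingletonAt adj c ε π u i := by
    intro u
    by_cases hu : u ∈ singletons adj c ε π
    · obtain ⟨i, hi⟩ := exists_becomesSingletonAt adj c ε π (Finset.mem_filter.mp hu).2
      exact ⟨i, fun _ => hi⟩
    · exact ⟨0, fun h => absurd h hu⟩
  choose t ht using hex
  calc ((Ebad adj c ε π).card : ℝ)
      ≤ ∑ u ∈ singletons adj c ε π, ((NdegI adj c ε π (t u) u).card : ℝ) := by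
        exact_mod_cast card_Ebad_le_sum adj c ε hsymm π t ht
    _ ≤ ∑ u ∈ singletons adj c ε π, ε * (deg adj u : ℝ) :=
        Finset.sum_le_sum fun u hu => hsing (t u) u (ht u hu)
    _ = ε * ((∑ u ∈ singletons adj c ε π, deg adj u : ℕ) : ℝ) := by
        rw [Nat.cast_sum, Finset.mul_sum]
    _ ≤ ε * ((2 * (Esin adj c ε π).card : ℕ) : ℝ) := by
        gcongr
        exact sum_deg_singletons_le adj c ε hsymm hirr π
    _ = 2 * ε * ((Esin adj c ε π).card : ℝ) := by push_cast; ring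


end TruncatedPivot
end

section
/- There exist constants C and n₀, depending only on c ≥ 3, such that for every ε ∈ (0,1) and every n ≥ n₀, with probability at least 1 − 1/n² over a uniformly random permutation π of V, the number of positive edges with at least one interesting endpoint (i.e. the number of edges of the graph with at least one endpoint in G_store) is at most C·n·log(n)/ε. -/
open scoped Classical

namespace TruncatedPivot

variable {N : ℕ}

/-- Revealing the values of a uniformly random permutation one at a time bounds the expectation
of a product of nonnegative perturbations of `1`: at step `i` there are `n - i` values left. -/
theorem sum_perm_prod_one_add_le (n : ℕ) (a : Fin n → Fin n → ℝ) (ha : ∀ i v, 0 ≤ a i v) :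
    ∑ σ : Equiv.Perm (Fin n), ∏ i, (1 + a i (σ i)) ≤
      (n.factorial : ℝ) * ∏ i : Fin n, (1 + (∑ v, a i v) / ((n : ℝ) - (i : ℕ))) := by
  induction n with
  | zero => simp
  | succ n ih =>
    have hpos : ∀ i : Fin n, (0 : ℝ) < (n : ℝ) - (i : ℕ) := fun i =>
      sub_pos.2 (by exact_mod_cast i.2)
    have hrest : ∀ p : Fin (n + 1),
        ∑ e : Equiv.Perm (Fin n), ∏ i : Fin n, (1 + a i.succ (Equiv.swap 0 p (e i).succ)) ≤
          (n.factorial : ℝ) * ∏ i : Fin n, (1 + (∑ v, a i.succ v) / ((n : ℝ) - (i : ℕ))) := by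
      intro p
      refine (ih (fun i v => a i.succ (Equiv.swap 0 p v.succ)) fun i v => ha _ _).trans ?_
      have hsum : ∀ i : Fin n,
          ∑ v : Fin n, a i.succ (Equiv.swap 0 p v.succ) ≤ ∑ v, a i.succ v := by
        intro i
        rw [← Equiv.sum_comp (Equiv.swap 0 p) (a i.succ), Fin.sum_univ_succ]
        exact le_add_of_nonneg_left (ha _ _)
      refine mul_le_mul_of_nonneg_left (Finset.prod_le_prod (fun i _ => ?_) fun i _ => ?_)
        (Nat.cast_nonneg _)
      · have := div_nonneg (Finset.sum_nonneg fun v (_ : v ∈ Finset.univ) =>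
          ha i.succ (Equiv.swap 0 p (Fin.succ v))) (hpos i).le
        linarith
      · have := div_le_div_of_nonneg_right (hsum i) (hpos i).le
        linarith
    calc ∑ σ : Equiv.Perm (Fin (n + 1)), ∏ i, (1 + a i (σ i))
        = ∑ p : Fin (n + 1), (1 + a 0 p) * ∑ e : Equiv.Perm (Fin n),
            ∏ i : Fin n, (1 + a i.succ (Equiv.swap 0 p (e i).succ)) := by
          rw [← Equiv.sum_comp Equiv.Perm.decomposeFin.symm, Fintype.sum_prod_type]
          refine Finset.sum_congr rfl fun p _ => ?_
          rw [Finset.mul_sum]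
          refine Finset.sum_congr rfl fun e _ => ?_
          rw [Fin.prod_univ_succ]
          simp
      _ ≤ ∑ p : Fin (n + 1), (1 + a 0 p) *
            ((n.factorial : ℝ) * ∏ i : Fin n, (1 + (∑ v, a i.succ v) / ((n : ℝ) - (i : ℕ)))) :=
          Finset.sum_le_sum fun p _ =>
            mul_le_mul_of_nonneg_left (hrest p) (by have := ha 0 p; linarith)
      _ = _ := by
          rw [← Finset.sum_mul, Fin.prod_univ_succ, Finset.sum_add_distrib, Nat.factorial_succ]
          have : (n : ℝ) + 1 ≠ 0 := by positivity
          simp only [Finset.sum_const, Finset.card_univ, Fintype.card_fin, nsmul_eq_mul, mul_one,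
            Fin.val_zero, Fin.val_succ]
          push_cast
          simp only [sub_zero, add_sub_add_right_eq_sub]
          field_simp

/-- The number of edges that `v` contributes when it is placed at (zero-based) position `i`, where
`v` is interesting iff `(i + 1) * deg v < L`. -/
noncomputable def storedDeg (adj : Fin N → Fin N → Bool) (L : ℝ) (i v : Fin N) : ℝ :=
  if ((i : ℕ) + 1 : ℝ) * (deg adj v : ℝ) < L then (deg adj v : ℝ) else 0

theorem storedDeg_nonneg (adj : Fin N → Fin N → Bool) (L : ℝ) (i v : Fin N) :
    0 ≤ storedDeg adj L i v := by
  unfold storedDeg; split_ifs <;> positivity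

theorem storedDeg_le_card (adj : Fin N → Fin N → Bool) (L : ℝ) (i v : Fin N) :
    storedDeg adj L i v ≤ N := by
  unfold storedDeg
  split_ifs
  · have : deg adj v ≤ N := (Finset.card_le_univ _).trans_eq (Fintype.card_fin N)
    exact_mod_cast this
  · positivity

theorem succ_mul_storedDeg_le (adj : Fin N → Fin N → Bool) {L : ℝ} (hL : 0 ≤ L) (i v : Fin N) :
    ((i : ℕ) + 1 : ℝ) * storedDeg adj L i v ≤ L := by
  unfold storedDeg
  split_ifs with h
  · exact h.le
  · simpa using hL

/-- Summed over all positions, a vertex contributes at most `L`. -/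
theorem sum_storedDeg_le (adj : Fin N → Fin N → Bool) {L : ℝ} (hL : 0 ≤ L) (v : Fin N) :
    ∑ i, storedDeg adj L i v ≤ L := by
  have key : ∀ k : ℕ, ∑ i ∈ Finset.range k,
      (if ((i : ℕ) + 1 : ℝ) * (deg adj v : ℝ) < L then (deg adj v : ℝ) else 0) ≤
        min L (k * (deg adj v : ℝ)) := by
    intro k
    induction k with
    | zero => simp [hL]
    | succ k ih =>
      rw [Finset.sum_range_succ]
      have h1 := ih.trans (min_le_left _ _)
      have h2 := ih.trans (min_le_right _ _)
      have h3 : (0 : ℝ) ≤ deg adj v := Nat.cast_nonneg _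
      push_cast
      split_ifs with h
      · exact le_min (by linarith) (by linarith)
      · exact le_min (by linarith) (by linarith)
  have := (key N).trans (min_le_left _ _)
  rwa [← Fin.sum_univ_eq_sum_range
    (fun i => if ((i : ℕ) + 1 : ℝ) * (deg adj v : ℝ) < L then (deg adj v : ℝ) else 0)] at this

/-- The edges with an interesting endpoint are counted by the degrees of the interesting nodes. -/
theorem card_interEdges_le (adj : Fin N → Fin N → Bool) (hsymm : ∀ u v, adj u v = adj v u)
    (c ε : ℝ) (π : Equiv.Perm (Fin N)) :
    ((interEdges adj c ε π).card : ℝ) ≤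
      ∑ i, storedDeg adj ((c / ε) * ((N : ℝ) * Real.log N)) i (π.symm i) := by
  set I := Finset.univ.filter fun u => interesting adj c ε π u with hI
  have h1 : (interEdges adj c ε π).card ≤ ∑ u ∈ I, deg adj u := by
    let f : (_ : Fin N) × Fin N → Sym2 (Fin N) := fun q => s(q.1, q.2)
    let T : Finset ((_ : Fin N) × Fin N) :=
      I.sigma fun u => Finset.univ.filter fun v => adj u v = true
    have hT : T.card = ∑ u ∈ I, deg adj u := Finset.card_sigma _ _
    rw [← hT]
    have hinj : Set.InjOn (fun p : Fin N × Fin N => s(p.1, p.2)) (interEdges adj c ε π) := by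
      rintro ⟨a, b⟩ hp ⟨a', b'⟩ hq h
      rw [Finset.mem_coe, interEdges, Finset.mem_filter] at hp hq
      rcases Sym2.eq_iff.1 h with ⟨h, h'⟩ | ⟨h, h'⟩
      · exact Prod.ext h h'
      · have hab : a < b := hp.2.1
        have hab' : a' < b' := hq.2.1
        change a = b' at h
        change b = a' at h'
        omega
    rw [← Finset.card_image_of_injOn hinj]
    refine (Finset.card_le_card (t := T.image f) fun e he => ?_).trans Finset.card_image_le
    obtain ⟨⟨a, b⟩, hp, rfl⟩ := Finset.mem_image.1 he
    simp only [interEdges, Finset.mem_filter, Finset.mem_univ, true_and] at hp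
    obtain ⟨-, hab, h | h⟩ := hp
    · exact Finset.mem_image.2 ⟨⟨a, b⟩, by simp [T, hI, h, hab], rfl⟩
    · exact Finset.mem_image.2 ⟨⟨b, a⟩, by simp [T, hI, h, hsymm b a, hab], Sym2.eq_swap⟩
  refine (Nat.cast_le.2 h1).trans_eq ?_
  rw [← Equiv.sum_comp π, Nat.cast_sum, hI, Finset.sum_filter]
  simp only [storedDeg, interesting, Equiv.symm_apply_apply]
  exact Finset.sum_congr rfl fun i _ => by congr

/-- The exponential moment of the contribution of the first half of the positions. -/
theorem sum_perm_exp_storedDeg_le (hN : 0 < N) (adj : Fin N → Fin N → Bool) {L : ℝ}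
    (hL : 0 ≤ L) :
    ∑ σ : Equiv.Perm (Fin N), Real.exp
        ((∑ i : Fin N, if 2 * (i : ℕ) < N then storedDeg adj L i (σ i) else 0) / N) ≤
      (N.factorial : ℝ) * Real.exp (4 * L / N) := by
  have hN' : (0 : ℝ) < N := by exact_mod_cast hN
  let a : Fin N → Fin N → ℝ := fun i v =>
    Real.exp ((if 2 * (i : ℕ) < N then storedDeg adj L i v else 0) / N) - 1
  have ha : ∀ i v, 0 ≤ a i v := by
    intro i v
    refine sub_nonneg.2 (Real.one_le_exp (div_nonneg ?_ hN'.le))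
    split_ifs
    exacts [storedDeg_nonneg adj L i v, le_rfl]
  have ha' : ∀ i v : Fin N, 2 * (i : ℕ) < N → a i v ≤ 2 * (storedDeg adj L i v / N) := by
    intro i v hi
    simp only [a, if_pos hi]
    have h0 : 0 ≤ storedDeg adj L i v / N := div_nonneg (storedDeg_nonneg adj L i v) hN'.le
    have h1 : storedDeg adj L i v / N ≤ 1 :=
      (div_le_one hN').2 (storedDeg_le_card adj L i v)
    have h2 := (abs_le.1 (Real.abs_exp_sub_one_le (abs_le.2 ⟨by linarith, h1⟩))).2
    rwa [abs_of_nonneg h0] at h2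
  have hfac : ∀ i : Fin N, 1 + (∑ v, a i v) / ((N : ℝ) - (i : ℕ)) ≤
      Real.exp (∑ v, 4 / (N : ℝ) ^ 2 * storedDeg adj L i v) := by
    intro i
    refine le_trans ?_ (Real.add_one_le_exp _)
    rw [add_comm]
    refine add_le_add_left ?_ _
    have hpos : (0 : ℝ) < (N : ℝ) - (i : ℕ) := sub_pos.2 (by exact_mod_cast i.2)
    by_cases hi : 2 * (i : ℕ) < N
    · have hi' : 2 * ((i : ℕ) : ℝ) < N := by exact_mod_cast hi
      rw [Finset.sum_div]
      refine Finset.sum_le_sum fun v _ => ?_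
      calc a i v / ((N : ℝ) - (i : ℕ)) ≤ a i v / ((N : ℝ) / 2) :=
            div_le_div_of_nonneg_left (ha i v) (by positivity) (by linarith)
        _ ≤ 2 * (storedDeg adj L i v / N) / ((N : ℝ) / 2) :=
            div_le_div_of_nonneg_right (ha' i v hi) (by positivity)
        _ = 4 / (N : ℝ) ^ 2 * storedDeg adj L i v := by field_simp; ring
    · have : ∀ v, a i v = 0 := fun v => by simp [a, hi]
      simp only [this, Finset.sum_const_zero, zero_div]
      exact Finset.sum_nonneg fun v _ => mul_nonneg (by positivity) (storedDeg_nonneg adj L i v)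
  calc ∑ σ : Equiv.Perm (Fin N), Real.exp
        ((∑ i : Fin N, if 2 * (i : ℕ) < N then storedDeg adj L i (σ i) else 0) / N)
      = ∑ σ : Equiv.Perm (Fin N), ∏ i, (1 + a i (σ i)) := by
        refine Finset.sum_congr rfl fun σ _ => ?_
        rw [Finset.sum_div, Real.exp_sum]
        exact Finset.prod_congr rfl fun i _ => by simp only [a]; ring
    _ ≤ (N.factorial : ℝ) * ∏ i : Fin N, (1 + (∑ v, a i v) / ((N : ℝ) - (i : ℕ))) :=
        sum_perm_prod_one_add_le N a ha
    _ ≤ (N.factorial : ℝ) * ∏ i : Fin N,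
          Real.exp (∑ v, 4 / (N : ℝ) ^ 2 * storedDeg adj L i v) := by
        refine mul_le_mul_of_nonneg_left (Finset.prod_le_prod (fun i _ => ?_) fun i _ => hfac i)
          (Nat.cast_nonneg _)
        have hpos : (0 : ℝ) < (N : ℝ) - (i : ℕ) := sub_pos.2 (by exact_mod_cast i.2)
        exact add_nonneg zero_le_one (div_nonneg (Finset.sum_nonneg fun v _ => ha i v) hpos.le)
    _ ≤ (N.factorial : ℝ) * Real.exp (4 * L / N) := by
        rw [← Real.exp_sum, Finset.sum_comm]
        refine mul_le_mul_of_nonneg_left (Real.exp_le_exp.2 ?_) (Nat.cast_nonneg _)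
        calc ∑ v, ∑ i, 4 / (N : ℝ) ^ 2 * storedDeg adj L i v
            ≤ ∑ _v : Fin N, 4 / (N : ℝ) ^ 2 * L := by
              refine Finset.sum_le_sum fun v _ => ?_
              rw [← Finset.mul_sum]
              exact mul_le_mul_of_nonneg_left (sum_storedDeg_le adj hL v) (by positivity)
          _ = 4 * L / N := by
              simp only [Finset.sum_const, Finset.card_univ, Fintype.card_fin, nsmul_eq_mul]
              field_simp

/-- The second half of the positions contributes at most `2 * L`, whatever the permutation. -/
theorem sum_storedDeg_le_add (hN : 0 < N) (adj : Fin N → Fin N → Bool) {L : ℝ} (hL : 0 ≤ L)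
    (σ : Equiv.Perm (Fin N)) :
    ∑ i, storedDeg adj L i (σ i) ≤
      (∑ i : Fin N, if 2 * (i : ℕ) < N then storedDeg adj L i (σ i) else 0) + 2 * L := by
  have hN' : (0 : ℝ) < N := by exact_mod_cast hN
  have : 2 * L = ∑ _i : Fin N, 2 * L / N := by
    simp only [Finset.sum_const, Finset.card_univ, Fintype.card_fin, nsmul_eq_mul]
    field_simp
  rw [this, ← Finset.sum_add_distrib]
  refine Finset.sum_le_sum fun i _ => ?_
  split_ifs with h
  · have : 0 ≤ 2 * L / N := by positivity
    linarith
  · have hi : (N : ℝ) ≤ 2 * (i : ℕ) := by exact_mod_cast not_lt.1 h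
    have h1 := succ_mul_storedDeg_le adj hL i (σ i)
    have h2 := storedDeg_nonneg adj L i (σ i)
    rw [zero_add, le_div_iff₀ hN']
    nlinarith

/-- There exist constants `C` and `n₀`, depending only on `c ≥ 3`, such
that for every `ε ∈ (0,1)` and every `n ≥ n₀`, with probability at least `1 − 1/n²` over
a uniformly random permutation, the number of positive edges with at least one interesting
endpoint is at most `C·n·log(n)/ε`. -/
theorem interEdges_small_whp (c : ℝ) (hc : 3 ≤ c) :
    ∃ C : ℝ, ∃ n₀ : ℕ, ∀ ε : ℝ, 0 < ε → ε < 1 → ∀ N : ℕ, n₀ ≤ N →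
      ∀ adj : Fin N → Fin N → Bool,
      (∀ u v, adj u v = adj v u) → (∀ u, adj u u = false) →
      1 - 1 / (N : ℝ) ^ 2 ≤
        Pr N (fun π =>
          ((interEdges adj c ε π).card : ℝ) ≤ C * (N : ℝ) * Real.log N / ε) := by
  refine ⟨7 * c, 1, fun ε hε hε1 N hN adj hsymm _ => ?_⟩
  have hN' : (1 : ℝ) ≤ N := by exact_mod_cast hN
  have hlog : 0 ≤ Real.log N := Real.log_nonneg hN'
  have hcε : 3 ≤ c / ε := (le_div_iff₀ hε).2 (by nlinarith)
  set L : ℝ := (c / ε) * ((N : ℝ) * Real.log N) with hLdef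
  have hL : 0 ≤ L := by positivity
  have hLN : L / N = c / ε * Real.log N := by rw [hLdef]; field_simp
  let X : Equiv.Perm (Fin N) → ℝ := fun σ =>
    ∑ i : Fin N, if 2 * (i : ℕ) < N then storedDeg adj L i (σ i) else 0
  let P : Equiv.Perm (Fin N) → Prop := fun π =>
    ((interEdges adj c ε π).card : ℝ) ≤ 7 * c * (N : ℝ) * Real.log N / ε
  have hbad : ∀ π, ¬ P π → 5 * L ≤ X π.symm := by
    intro π hπ
    have h1 := card_interEdges_le adj hsymm c ε π
    have h2 := sum_storedDeg_le_add hN adj hL π.symm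
    have h3 : 7 * c * (N : ℝ) * Real.log N / ε = 7 * L := by rw [hLdef]; field_simp
    have h4 : 7 * L < ((interEdges adj c ε π).card : ℝ) := by rw [← h3]; exact not_le.1 hπ
    change 5 * L ≤ ∑ i : Fin N, if 2 * (i : ℕ) < N then storedDeg adj L i (π.symm i) else 0
    linarith
  have hmarkov : ((Finset.univ.filter fun π => ¬ P π).card : ℝ) * Real.exp (5 * L / N) ≤
      (N.factorial : ℝ) * Real.exp (4 * L / N) := by
    refine le_trans ?_ (sum_perm_exp_storedDeg_le hN adj hL)
    rw [← Equiv.sum_comp (Equiv.inv (Equiv.Perm (Fin N))), ← nsmul_eq_mul, ← Finset.sum_const]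
    refine (Finset.sum_le_sum fun π hπ => ?_).trans
      (Finset.sum_le_sum_of_subset_of_nonneg (Finset.filter_subset _ _)
        fun _ _ _ => (Real.exp_pos _).le)
    exact Real.exp_le_exp.2
      (div_le_div_of_nonneg_right (hbad π (Finset.mem_filter.1 hπ).2) (by positivity))
  have hexp : (N : ℝ) ^ 2 * Real.exp (4 * L / N) ≤ Real.exp (5 * L / N) := by
    have : (N : ℝ) ^ 2 = Real.exp (2 * Real.log N) := by
      rw [two_mul, Real.exp_add, Real.exp_log (by linarith), sq]
    rw [this, ← Real.exp_add, mul_div_assoc 4 L, mul_div_assoc 5 L, hLN]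
    exact Real.exp_le_exp.2 (by nlinarith)
  have hfac : (0 : ℝ) < N.factorial := by exact_mod_cast N.factorial_pos
  have hcard : ((Finset.univ.filter fun π => ¬ P π).card : ℝ) * (N : ℝ) ^ 2 ≤ N.factorial := by
    refine le_of_mul_le_mul_right ?_ (Real.exp_pos (4 * L / N))
    rw [mul_assoc]
    exact (mul_le_mul_of_nonneg_left hexp (Nat.cast_nonneg _)).trans hmarkov
  have htotal : ((Finset.univ.filter P).card : ℝ) +
      ((Finset.univ.filter fun π => ¬ P π).card : ℝ) = N.factorial := by
    have h := Finset.card_filter_add_card_filter_not (s := Finset.univ) P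
    rw [Finset.card_univ, Fintype.card_perm, Fintype.card_fin] at h
    exact_mod_cast h
  change 1 - 1 / (N : ℝ) ^ 2 ≤ ((Finset.univ.filter P).card : ℝ) / N.factorial
  rw [le_div_iff₀ hfac]
  have := (le_div_iff₀ (by positivity : (0 : ℝ) < (N : ℝ) ^ 2)).2 hcard
  rw [sub_mul, one_mul, one_div_mul_eq_div]
  linarith


end TruncatedPivot
end

section
/- Over a uniformly random permutation π of V, the expected number of positive edges with at least one interesting endpoint is at most (c/ε)·n·log n. -/
open scoped Classical

namespace TruncatedPivot

variable {N : ℕ}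

/-- The average over permutations of `f (π u)` is the average of `f`. -/
theorem card_mul_sum_perm_apply (f : Fin N → ℝ) (u : Fin N) :
    (N : ℝ) * ∑ π : Equiv.Perm (Fin N), f (π u) = (N.factorial : ℝ) * ∑ k, f k := by
  have hconst (v : Fin N) :
      ∑ π : Equiv.Perm (Fin N), f (π v) = ∑ π : Equiv.Perm (Fin N), f (π u) := by
    rw [← Equiv.sum_comp (Equiv.mulRight (Equiv.swap u v))]
    simp
  calc (N : ℝ) * ∑ π : Equiv.Perm (Fin N), f (π u)
      = ∑ v : Fin N, ∑ π : Equiv.Perm (Fin N), f (π v) := by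
        simp [hconst]
    _ = ∑ π : Equiv.Perm (Fin N), ∑ v, f (π v) := Finset.sum_comm
    _ = (N.factorial : ℝ) * ∑ k, f k := by
        simp [Equiv.sum_comp, Fintype.card_perm]

/-- At most `T / d` of the positions `1, …, N` lie strictly below `T / d`. -/
theorem card_positions_mul_le (d T : ℝ) (hd : 0 ≤ d) (hT : 0 ≤ T) :
    ((Finset.univ.filter fun k : Fin N => ((k.val : ℝ) + 1) * d < T).card : ℝ) * d ≤ T := by
  set S := Finset.univ.filter fun k : Fin N => ((k.val : ℝ) + 1) * d < T with hS
  by_contra! h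
  have hlt : ∀ k ∈ S, k.val + 1 < S.card := by
    intro k hk
    have hk' : ((k.val : ℝ) + 1) * d < T := by simpa [hS] using hk
    have := lt_of_mul_lt_mul_right (hk'.trans h) hd
    exact_mod_cast this
  have hcard : S.card ≤ (Finset.range (S.card - 1)).card :=
    Finset.card_le_card_of_injOn Fin.val
      (fun k hk => by have := hlt k hk; simp; omega) Fin.val_injective.injOn
  have hzero : S.card = 0 := by
    rw [Finset.card_range] at hcard
    omega
  rw [hzero] at h
  simp at h
  linarith

/-- Charging every edge of `interEdges` to an interesting endpoint. -/
theorem card_interEdges_le_sum_deg (adj : Fin N → Fin N → Bool) (c ε : ℝ)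
    (hsymm : ∀ u v, adj u v = adj v u) (π : Equiv.Perm (Fin N)) :
    (interEdges adj c ε π).card ≤ ∑ u, if interesting adj c ε π u then deg adj u else 0 := by
  have hsum : (Finset.univ.filter fun p : Fin N × Fin N =>
      interesting adj c ε π p.1 ∧ adj p.1 p.2 = true).card =
        ∑ u, if interesting adj c ε π u then deg adj u else 0 := by
    rw [Finset.card_filter, Fintype.sum_prod_type]
    refine Finset.sum_congr rfl fun u _ => ?_
    by_cases hu : interesting adj c ε π u <;> simp [hu, deg]
  rw [← hsum]
  refine Finset.card_le_card_of_injOn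
    (fun p => if interesting adj c ε π p.1 then p else p.swap) ?_ ?_
  · intro p hp
    have hp' : p.1 < p.2 ∧ adj p.1 p.2 = true ∧
        (interesting adj c ε π p.1 ∨ interesting adj c ε π p.2) := by
      simpa [interEdges] using hp
    obtain ⟨-, hadj, hint⟩ := hp'
    by_cases h : interesting adj c ε π p.1
    · simp [h, hadj]
    · simp [h, hint.resolve_left h, ← hsymm p.1 p.2, hadj]
  · intro p hp q hq hpq
    have hp' : p.1 < p.2 := (Finset.mem_filter.mp hp).2.1
    have hq' : q.1 < q.2 := (Finset.mem_filter.mp hq).2.1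
    dsimp only at hpq
    split_ifs at hpq
    · exact hpq
    · rw [hpq] at hp'
      exact absurd hp' hq'.asymm
    · rw [← hpq] at hq'
      exact absurd hq' hp'.asymm
    · exact Prod.swap_injective hpq

/-- Over a uniformly random permutation, the expected number of positive
edges with at least one interesting endpoint is at most `(c/ε)·n·log n`. -/
theorem expected_interEdges_le (N : ℕ) (hN : 2 ≤ N) (c ε : ℝ) (hc : 0 < c)
    (hε0 : 0 < ε) (hε1 : ε < 1) (adj : Fin N → Fin N → Bool)
    (hsymm : ∀ u v, adj u v = adj v u) (hirr : ∀ u, adj u u = false) :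
    Ex N (fun π => ((interEdges adj c ε π).card : ℝ)) ≤
      (c / ε) * (N : ℝ) * Real.log N := by
  set T : ℝ := (c / ε) * ((N : ℝ) * Real.log N) with hT
  have hT0 : 0 ≤ T := by positivity
  have hN0 : (0 : ℝ) < N := by exact_mod_cast (by omega : 0 < N)
  have hF : (0 : ℝ) < N.factorial := by exact_mod_cast N.factorial_pos
  let f : Fin N → Fin N → ℝ := fun u k =>
    if ((k.val : ℝ) + 1) * (deg adj u : ℝ) < T then (deg adj u : ℝ) else 0
  have hnode (u : Fin N) : (N : ℝ) * ∑ π : Equiv.Perm (Fin N), f u (π u) ≤ N.factorial * T := by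
    rw [card_mul_sum_perm_apply]
    refine mul_le_mul_of_nonneg_left ?_ hF.le
    have hcount := card_positions_mul_le (N := N) (deg adj u : ℝ) T (Nat.cast_nonneg _) hT0
    simpa [f, ← Finset.sum_filter] using hcount
  have hbound : ∑ π : Equiv.Perm (Fin N), ((interEdges adj c ε π).card : ℝ) ≤
      ∑ u, ∑ π : Equiv.Perm (Fin N), f u (π u) := by
    rw [Finset.sum_comm]
    refine Finset.sum_le_sum fun π _ => ?_
    have h : ((interEdges adj c ε π).card : ℝ) ≤
        ((∑ u, if interesting adj c ε π u then deg adj u else 0 : ℕ) : ℝ) :=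
      Nat.cast_le.mpr (card_interEdges_le_sum_deg adj c ε hsymm π)
    refine h.trans_eq ?_
    rw [Nat.cast_sum]
    refine Finset.sum_congr rfl fun u _ => ?_
    by_cases hu : interesting adj c ε π u
    · rw [if_pos hu]
      exact (if_pos hu).symm
    · rw [if_neg hu, Nat.cast_zero]
      exact (if_neg hu).symm
  have htotal : (N : ℝ) * ∑ u, ∑ π : Equiv.Perm (Fin N), f u (π u) ≤
      N * (N.factorial * T) := by
    rw [Finset.mul_sum]
    exact (Finset.sum_le_sum fun u _ => hnode u).trans_eq (by simp)
  rw [Ex, div_le_iff₀ hF]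
  calc ∑ π : Equiv.Perm (Fin N), ((interEdges adj c ε π).card : ℝ)
      ≤ N.factorial * T := hbound.trans (le_of_mul_le_mul_left htotal hN0)
    _ = (c / ε) * (N : ℝ) * Real.log N * N.factorial := by rw [hT]; ring


end TruncatedPivot
end
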